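/- arXiv:2507.09526 — 2 statements merged into one kernel-verified Lean document; each statement's English description precedes it below -/
import Mathlib

section
/- Let (V, V₊, v) and (W, W₊, w) be (not necessarily complete) order unit spaces with open cones C := V₊° and D := W₊°. If there exists a gauge-reversing bijection Φ: C → D, then V and W are isomorphic as ordered vector spaces: there exists a linear bijection T: V → W with T(V₊) = W₊. -/
open scoped Topology

section Defs

/-- `(V, P, v)` is an order unit space: `P` is a proper cone, the induced order is
archimedean, `v` is an order unit, and the norm of `V` is the order unit norm. -/
structure IsOrderUnitSpace (V : Type*) [NormedAddCommGroup V] [NormedSpace ℝ V]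
    (P : Set V) (v : V) : Prop where
  add_mem : ∀ x ∈ P, ∀ y ∈ P, x + y ∈ P
  smul_mem : ∀ r : ℝ, 0 ≤ r → ∀ x ∈ P, r • x ∈ P
  proper : ∀ x : V, x ∈ P → -x ∈ P → x = 0
  archimedean : ∀ x b : V, (∀ r : ℝ, 0 ≤ r → b - r • x ∈ P) → -x ∈ P
  unit_mem : v ∈ P
  unit_order : ∀ x : V, ∃ r : ℝ, 0 < r ∧ r • v - x ∈ P
  norm_eq : ∀ x : V, ‖x‖ = sInf {r : ℝ | 0 ≤ r ∧ x + r • v ∈ P ∧ r • v - x ∈ P}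

variable {V : Type*} [NormedAddCommGroup V] [NormedSpace ℝ V]
variable {W : Type*} [NormedAddCommGroup W] [NormedSpace ℝ W]

/-- The open cone (norm interior of the cone `P`) of an order unit space. -/
def openCone (P : Set V) (v : V) : Set V := {x | ∃ ε : ℝ, 0 < ε ∧ x - ε • v ∈ P}

/-- The order unit norm `‖x‖_u` determined by an order unit `u`. -/
noncomputable def ounorm (P : Set V) (u x : V) : ℝ :=
  sInf {r : ℝ | 0 ≤ r ∧ x + r • u ∈ P ∧ r • u - x ∈ P}

/-- Thompson's metric `d_T(x,y) = log inf {r ≥ 1 : r⁻¹ y ≤ x ≤ r y}`. -/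
noncomputable def thompsonDist (P : Set V) (x y : V) : ℝ :=
  Real.log (sInf {r : ℝ | 1 ≤ r ∧ x - r⁻¹ • y ∈ P ∧ r • y - x ∈ P})

/-- `Φ` is a gauge-reversing bijection from the open cone of `(V, P, v)` onto the
open cone of `(W, Q, w)`: a bijection, homogeneous of degree `-1`,
and an order-anti-isomorphism. -/
def GaugeReversing (P : Set V) (v : V) (Q : Set W) (w : W) (Φ : V → W) : Prop :=
  Set.BijOn Φ (openCone P v) (openCone Q w) ∧
  (∀ x ∈ openCone P v, ∀ r : ℝ, 0 < r → Φ (r • x) = r⁻¹ • Φ x) ∧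
  (∀ x ∈ openCone P v, ∀ y ∈ openCone P v, (y - x ∈ P ↔ Φ x - Φ y ∈ Q))

/-- `Φ` is a gauge-preserving bijection from the open cone of `(V, P, v)` onto the
open cone of `(W, Q, w)`: a bijection, homogeneous of degree `1`,
and an order-isomorphism. -/
def GaugePreserving (P : Set V) (v : V) (Q : Set W) (w : W) (Φ : V → W) : Prop :=
  Set.BijOn Φ (openCone P v) (openCone Q w) ∧
  (∀ x ∈ openCone P v, ∀ r : ℝ, 0 < r → Φ (r • x) = r • Φ x) ∧
  (∀ x ∈ openCone P v, ∀ y ∈ openCone P v, (y - x ∈ P ↔ Φ y - Φ x ∈ Q))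

/-- `mul` is a JB-algebra structure on the order unit space `(V, P, v)` with unit
element `v` and cone of squares `P`. -/
def IsJBAlgebraStructure (P : Set V) (v : V) (mul : V →ₗ[ℝ] V →ₗ[ℝ] V) : Prop :=
  (∀ x y : V, mul x y = mul y x) ∧
  (∀ x : V, mul v x = x) ∧
  (∀ x y : V, mul x (mul y (mul x x)) = mul (mul x y) (mul x x)) ∧
  (∀ x y : V, ‖mul x y‖ ≤ ‖x‖ * ‖y‖) ∧
  (∀ x : V, ‖mul x x‖ = ‖x‖ ^ 2) ∧
  (∀ x y : V, ‖mul x x‖ ≤ ‖mul x x + mul y y‖) ∧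
  P = {y : V | ∃ x : V, mul x x = y}

/-- `S` is a `d_T`-symmetry of the open cone of `(V, P, v)` at the point `p`:
an involutive `d_T`-isometry of the open cone having `p` as an isolated fixed point. -/
def IsDTSymmetry (P : Set V) (v : V) (S : V → V) (p : V) : Prop :=
  (∀ x ∈ openCone P v, S x ∈ openCone P v) ∧
  (∀ x ∈ openCone P v, S (S x) = x) ∧
  (∀ x ∈ openCone P v, ∀ y ∈ openCone P v,
    thompsonDist P (S x) (S y) = thompsonDist P x y) ∧
  p ∈ openCone P v ∧ S p = p ∧
  (∃ ε : ℝ, 0 < ε ∧ ∀ x ∈ openCone P v, S x = x → thompsonDist P p x < ε → x = p)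

/-- A complete order unit space `(W, Q, w)` together with a gauge-reversing bijection
from the open cone of `(V, P, v)` onto the open cone of `(W, Q, w)`. -/
structure GaugeReversingTarget (V : Type*) [NormedAddCommGroup V] [NormedSpace ℝ V]
    (P : Set V) (v : V) where
  W : Type
  [instGroup : NormedAddCommGroup W]
  [instSpace : NormedSpace ℝ W]
  [instComplete : CompleteSpace W]
  Q : Set W
  w : W
  ous : IsOrderUnitSpace W Q w
  Φ : V → W
  grev : GaugeReversing P v Q w Φ

/-- The state space of the order unit space `(V, P, v)`, as a subset of the
weak-* dual of `V`. -/
def stateSpace (P : Set V) (v : V) : Set (WeakDual ℝ V) :=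
  {ρ | (∀ x ∈ P, 0 ≤ ρ x) ∧ ρ v = 1}

/-- A real-valued function on the dual is affine on `K`. -/
def AffineOnK (K : Set (WeakDual ℝ V)) (g : WeakDual ℝ V → ℝ) : Prop :=
  ∀ ρ ∈ K, ∀ σ ∈ K, ∀ t : ℝ, 0 ≤ t → t ≤ 1 →
    g ((1 - t) • ρ + t • σ) = (1 - t) * g ρ + t * g σ

/-- An extended-real-valued function on the dual is affine on `K`. -/
def AffineOnKE (K : Set (WeakDual ℝ V)) (g : WeakDual ℝ V → EReal) : Prop :=
  ∀ ρ ∈ K, ∀ σ ∈ K, ∀ t : ℝ, 0 ≤ t → t ≤ 1 →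
    g ((1 - t) • ρ + t • σ) = ((1 - t : ℝ) : EReal) * g ρ + ((t : ℝ) : EReal) * g σ

/-- Membership in the extended cone `C_usc` of nonnegative affine upper semicontinuous
functions on the state space `K`. -/
def memCusc (K : Set (WeakDual ℝ V)) (g : WeakDual ℝ V → ℝ) : Prop :=
  (∀ ρ ∈ K, 0 ≤ g ρ) ∧ AffineOnK K g ∧ UpperSemicontinuousOn g K

/-- `p` is an extremal vector of the cone `C_usc` over the state space `K`. -/
def IsExtremalCusc (K : Set (WeakDual ℝ V)) (p : WeakDual ℝ V → ℝ) : Prop :=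
  memCusc K p ∧ (∃ ρ ∈ K, p ρ ≠ 0) ∧
  ∀ x, memCusc K x → (∀ ρ ∈ K, x ρ ≤ p ρ) →
    ∃ t : ℝ, 0 ≤ t ∧ t ≤ 1 ∧ ∀ ρ ∈ K, x ρ = t * p ρ

/-- The cone `C_usc` over the state space `K` is strongly atomic: each of its
members is the least upper bound of the extremal vectors it dominates. -/
def StronglyAtomicCusc (K : Set (WeakDual ℝ V)) : Prop :=
  ∀ g, memCusc K g →
    (∀ p, IsExtremalCusc K p → (∀ ρ ∈ K, p ρ ≤ g ρ) → ∀ ρ ∈ K, p ρ ≤ g ρ) ∧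
    (∀ h, memCusc K h →
      (∀ p, IsExtremalCusc K p → (∀ ρ ∈ K, p ρ ≤ g ρ) → ∀ ρ ∈ K, p ρ ≤ h ρ) →
      ∀ ρ ∈ K, g ρ ≤ h ρ)

end Defs

namespace IsOrderUnitSpace

variable {V : Type*} [NormedAddCommGroup V] [NormedSpace ℝ V] {P : Set V} {v : V}

lemma zero_mem (hV : IsOrderUnitSpace V P v) : (0 : V) ∈ P := by
  simpa using hV.smul_mem 0 le_rfl v hV.unit_mem

lemma antisymm (hV : IsOrderUnitSpace V P v) {x y : V} (h₁ : y - x ∈ P) (h₂ : x - y ∈ P) :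
    x = y := by
  have := hV.proper (y - x) h₁ (by rwa [neg_sub])
  exact (sub_eq_zero.mp this).symm

lemma mem_of_norm_lt (hV : IsOrderUnitSpace V P v) {x : V} {r : ℝ} (h : ‖x‖ < r) :
    x + r • v ∈ P ∧ r • v - x ∈ P := by
  rw [hV.norm_eq] at h
  obtain ⟨s, ⟨-, h₁, h₂⟩, hs⟩ := exists_lt_of_csInf_lt (by
    obtain ⟨a, ha, ha'⟩ := hV.unit_order x
    obtain ⟨b, hb, hb'⟩ := hV.unit_order (-x)
    refine ⟨a + b, by positivity, ?_, ?_⟩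
    · convert hV.add_mem _ hb' _ (hV.smul_mem a ha.le _ hV.unit_mem) using 1
      module
    · convert hV.add_mem _ ha' _ (hV.smul_mem b hb.le _ hV.unit_mem) using 1
      module) h
  have h₃ := hV.smul_mem (r - s) (by linarith) _ hV.unit_mem
  constructor
  · convert hV.add_mem _ h₁ _ h₃ using 1
    module
  · convert hV.add_mem _ h₂ _ h₃ using 1
    module

lemma openCone_subset (hV : IsOrderUnitSpace V P v) : openCone P v ⊆ P := by
  rintro x ⟨ε, hε, hx⟩
  convert hV.add_mem _ hx _ (hV.smul_mem ε hε.le _ hV.unit_mem) using 1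
  module

lemma unit_mem_openCone (hV : IsOrderUnitSpace V P v) : v ∈ openCone P v :=
  ⟨1, one_pos, by simpa using hV.zero_mem⟩

lemma openCone_add (hV : IsOrderUnitSpace V P v) {x y : V} (hx : x ∈ openCone P v)
    (hy : y ∈ P) : x + y ∈ openCone P v := by
  obtain ⟨ε, hε, hx⟩ := hx
  refine ⟨ε, hε, ?_⟩
  convert hV.add_mem _ hx _ hy using 1
  module

lemma openCone_of_sub_mem (hV : IsOrderUnitSpace V P v) {x y : V} (hx : x ∈ openCone P v)
    (hy : y - x ∈ P) : y ∈ openCone P v := by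
  simpa using hV.openCone_add hx hy

lemma openCone_smul (hV : IsOrderUnitSpace V P v) {x : V} (hx : x ∈ openCone P v) {r : ℝ}
    (hr : 0 < r) : r • x ∈ openCone P v := by
  obtain ⟨ε, hε, hx⟩ := hx
  refine ⟨r * ε, by positivity, ?_⟩
  convert hV.smul_mem r hr.le _ hx using 1
  module

lemma exists_smul_sub_mem (hV : IsOrderUnitSpace V P v) {c : V} (hc : c ∈ openCone P v) (x : V) :
    ∃ r : ℝ, 0 < r ∧ r • c - x ∈ openCone P v := by
  obtain ⟨ε, hε, hc⟩ := hc
  obtain ⟨r, hr, hx⟩ := hV.unit_order x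
  refine ⟨(r + 1) / ε, by positivity, 1, one_pos, ?_⟩
  convert hV.add_mem _ (hV.smul_mem ((r + 1) / ε) (by positivity) _ hc) _ hx using 1
  match_scalars <;> field_simp
  ring

lemma isOpen_openCone (hV : IsOrderUnitSpace V P v) : IsOpen (openCone P v) := by
  rw [Metric.isOpen_iff]
  rintro x ⟨ε, hε, hx⟩
  refine ⟨ε / 2, by positivity, fun y hy => ⟨ε / 2, by positivity, ?_⟩⟩
  rw [Metric.mem_ball, dist_eq_norm] at hy
  convert hV.add_mem _ hx _ (hV.mem_of_norm_lt hy).1 using 1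
  module

lemma convex_openCone (hV : IsOrderUnitSpace V P v) : Convex ℝ (openCone P v) := by
  rintro x ⟨ε, hε, hx⟩ y ⟨δ, hδ, hy⟩ a b ha hb hab
  refine ⟨a * ε + b * δ, ?_, ?_⟩
  · rcases ha.eq_or_lt with rfl | ha
    · rw [zero_add] at hab
      subst hab
      simpa using hδ
    · positivity
  · convert hV.add_mem _ (hV.smul_mem a ha _ hx) _ (hV.smul_mem b hb _ hy) using 1
    module

lemma nonneg_of_bddBelow (hV : IsOrderUnitSpace V P v) (f : V →L[ℝ] ℝ) (m : ℝ)
    (hf : ∀ c ∈ openCone P v, m ≤ f c) {x : V} (hx : x ∈ P) : 0 ≤ f x := by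
  by_contra! h
  obtain ⟨n, hn⟩ := exists_nat_gt ((m - f v) / f x)
  have := hf (v + (n : ℝ) • x)
    (hV.openCone_add hV.unit_mem_openCone (hV.smul_mem _ n.cast_nonneg _ hx))
  rw [map_add, map_smul, smul_eq_mul] at this
  rw [div_lt_iff_of_neg h] at hn
  linarith

lemma eq_zero_of_nonneg (hV : IsOrderUnitSpace V P v) (f : V →L[ℝ] ℝ) (hf : ∀ x ∈ P, 0 ≤ f x)
    (hv : f v = 0) : f = 0 := by
  ext x
  obtain ⟨h₁, h₂⟩ := hV.mem_of_norm_lt (lt_add_one ‖x‖)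
  have h₁ := hf _ h₁
  have h₂ := hf _ h₂
  simp only [map_add, map_sub, map_smul, hv, smul_zero] at h₁ h₂
  simp only [zero_apply]
  linarith

lemma pos_of_mem_openCone {f : V →L[ℝ] ℝ} (hf : ∀ x ∈ P, 0 ≤ f x)
    (hv : 0 < f v) {x : V} (hx : x ∈ openCone P v) : 0 < f x := by
  obtain ⟨ε, hε, hx⟩ := hx
  have := hf _ hx
  rw [map_sub, map_smul, smul_eq_mul] at this
  nlinarith [mul_pos hε hv]

lemma mem_of_forall_add_smul_mem (hV : IsOrderUnitSpace V P v) {x : V}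
    (h : ∀ ε : ℝ, 0 < ε → x + ε • v ∈ P) : x ∈ P := by
  have := hV.archimedean (-x) v fun r hr => by
    rcases hr.eq_or_lt with rfl | hr
    · simpa using hV.unit_mem
    · convert hV.smul_mem r hr.le _ (h r⁻¹ (by positivity)) using 1
      match_scalars <;> field_simp
  rwa [neg_neg] at this

lemma exists_state_neg (hV : IsOrderUnitSpace V P v) {x : V} (hx : x ∉ P) :
    ∃ ρ ∈ stateSpace P v, ρ x < 0 := by
  obtain ⟨ε, hε, hxε⟩ : ∃ ε : ℝ, 0 < ε ∧ x + ε • v ∉ P := by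
    contrapose! hx
    exact hV.mem_of_forall_add_smul_mem hx
  obtain ⟨f, hf⟩ := geometric_hahn_banach_point_open hV.convex_openCone hV.isOpen_openCone
    (fun h => hxε (hV.openCone_subset h))
  have hpos : ∀ y ∈ P, 0 ≤ f y := fun y hy =>
    hV.nonneg_of_bddBelow f _ (fun c hc => (hf c hc).le) hy
  have hv : 0 < f v := by
    refine (hpos v hV.unit_mem).lt_of_ne' fun h => ?_
    have := hf v hV.unit_mem_openCone
    rw [hV.eq_zero_of_nonneg f hpos h] at this
    simp at this
  have hneg : f x < 0 := by
    have := hf (ε • v) (hV.openCone_smul hV.unit_mem_openCone hε)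
    rw [map_add] at this
    linarith
  refine ⟨StrongDual.toWeakDual ((f v)⁻¹ • f), ⟨fun y hy => ?_, ?_⟩, ?_⟩
  · have := hpos y hy
    simp only [StrongDual.toWeakDual_apply, smul_apply, smul_eq_mul]
    positivity
  · exact inv_mul_cancel₀ hv.ne'
  · simp only [StrongDual.toWeakDual_apply, smul_apply, smul_eq_mul]
    exact mul_neg_of_pos_of_neg (by positivity) hneg

lemma isCompact_stateSpace (hV : IsOrderUnitSpace V P v) : IsCompact (stateSpace P v) := by
  refine (WeakDual.isCompact_polar ℝ (Metric.ball_mem_nhds (0 : V) one_pos)).of_isClosed_subset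
    ?_ ?_
  · have : stateSpace P v = (⋂ x ∈ P, {ρ : WeakDual ℝ V | 0 ≤ ρ x}) ∩ {ρ | ρ v = 1} := by
      ext ρ
      simp [stateSpace]
    rw [this]
    exact (isClosed_biInter fun x _ => isClosed_le continuous_const
      (WeakDual.eval_continuous x)).inter (isClosed_eq (WeakDual.eval_continuous v) continuous_const)
  · rintro ρ ⟨hρ, hρv⟩ x hx
    rw [mem_ball_zero_iff] at hx
    obtain ⟨h₁, h₂⟩ := hV.mem_of_norm_lt hx
    have h₁ := hρ _ h₁
    have h₂ := hρ _ h₂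
    simp only [map_add, map_sub, one_smul, hρv] at h₁ h₂
    change ‖ρ x‖ ≤ 1
    rw [Real.norm_eq_abs, abs_le]
    constructor <;> linarith

lemma convex_stateSpace : Convex ℝ (stateSpace P v) := by
  rintro ρ ⟨hρ, hρv⟩ σ ⟨hσ, hσv⟩ a b ha hb hab
  refine ⟨fun x hx => ?_, ?_⟩
  · change 0 ≤ a * ρ x + b * σ x
    have := hρ x hx
    have := hσ x hx
    positivity
  · change a * ρ v + b * σ v = 1
    rw [hρv, hσv]
    linarith

end IsOrderUnitSpace

/-- A state of `(V, P, v)` that spans an extreme ray of the dual cone. -/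
structure IsPureState {V : Type*} [NormedAddCommGroup V] [NormedSpace ℝ V] (P : Set V) (v : V)
    (φ : V →L[ℝ] ℝ) : Prop where
  nonneg : ∀ x ∈ P, 0 ≤ φ x
  map_unit : φ v = 1
  eq_smul : ∀ ψ : V →L[ℝ] ℝ, (∀ x ∈ P, 0 ≤ ψ x) → (∀ x ∈ P, ψ x ≤ φ x) → ψ = ψ v • φ

namespace IsOrderUnitSpace

variable {V : Type*} [NormedAddCommGroup V] [NormedSpace ℝ V] {P : Set V} {v : V}

lemma isPureState_of_mem_extremePoints (hV : IsOrderUnitSpace V P v) {φ : WeakDual ℝ V}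
    (hφ : φ ∈ (stateSpace P v).extremePoints ℝ) : IsPureState P v (WeakDual.toStrongDual φ) := by
  obtain ⟨⟨hφP, hφv⟩, hext⟩ := hφ
  refine ⟨hφP, hφv, fun ψ hψ hle => ?_⟩
  have hle' : ∀ x ∈ P, ψ x ≤ φ x := hle
  have h0 := hψ v hV.unit_mem
  have h1 := hle' v hV.unit_mem
  rw [hφv] at h1
  rcases h0.eq_or_lt with h0 | h0
  · rw [← h0, zero_smul]
    exact hV.eq_zero_of_nonneg ψ hψ h0.symm
  rcases h1.eq_or_lt with h1 | h1
  · rw [h1, one_smul]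
    have := hV.eq_zero_of_nonneg (WeakDual.toStrongDual φ - ψ)
      (fun x hx => sub_nonneg.mpr (hle x hx)) (show φ v - ψ v = 0 by rw [hφv, h1, sub_self])
    exact (sub_eq_zero.mp this).symm
  have h1' : 0 < 1 - ψ v := by linarith
  have key := hext (x₁ := StrongDual.toWeakDual ((ψ v)⁻¹ • ψ))
    (x₂ := StrongDual.toWeakDual ((1 - ψ v)⁻¹ • (WeakDual.toStrongDual φ - ψ)))
    ⟨fun x hx => ?_, ?_⟩ ⟨fun x hx => ?_, ?_⟩
    ⟨ψ v, 1 - ψ v, h0, h1', by ring, ?_⟩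
  · ext x
    have := congrArg (fun ρ : WeakDual ℝ V => ρ x) key
    change (ψ v)⁻¹ * ψ x = φ x at this
    change ψ x = ψ v * φ x
    rw [← this, mul_inv_cancel_left₀ h0.ne']
  · change 0 ≤ (ψ v)⁻¹ * ψ x
    have := hψ x hx
    positivity
  · exact inv_mul_cancel₀ h0.ne'
  · change 0 ≤ (1 - ψ v)⁻¹ * (φ x - ψ x)
    have := sub_nonneg.mpr (hle' x hx)
    positivity
  · change (1 - ψ v)⁻¹ * (φ v - ψ v) = 1
    rw [hφv]
    exact inv_mul_cancel₀ h1'.ne'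
  · refine DFunLike.ext _ _ fun x => ?_
    change ψ v * ((ψ v)⁻¹ * ψ x) + (1 - ψ v) * ((1 - ψ v)⁻¹ * (φ x - ψ x)) = φ x
    field_simp
    ring

lemma mem_of_forall_isPureState (hV : IsOrderUnitSpace V P v) {x : V}
    (h : ∀ φ, IsPureState P v φ → 0 ≤ φ x) : x ∈ P := by
  by_contra hx
  obtain ⟨ρ, hρ, hneg⟩ := hV.exists_state_neg hx
  have : LocallyConvexSpace ℝ (WeakDual ℝ V) :=
    inferInstanceAs (LocallyConvexSpace ℝ (WeakBilin (topDualPairing ℝ V)))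
  rw [← closure_convexHull_extremePoints hV.isCompact_stateSpace convex_stateSpace] at hρ
  have hsub : closure (convexHull ℝ ((stateSpace P v).extremePoints ℝ)) ⊆
      {ρ : WeakDual ℝ V | 0 ≤ ρ x} := by
    refine closure_minimal (convexHull_min (fun φ hφ => h _
      (hV.isPureState_of_mem_extremePoints hφ)) ?_)
      (isClosed_le continuous_const (WeakDual.eval_continuous x))
    intro ρ hρ σ hσ a b ha hb _
    change 0 ≤ a * ρ x + b * σ x
    have : 0 ≤ ρ x := hρ
    have : 0 ≤ σ x := hσ
    positivity
  have : 0 ≤ ρ x := hsub hρ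
  linarith

lemma eq_smul_of_le (hV : IsOrderUnitSpace V P v) {φ ψ : V →L[ℝ] ℝ} (hφ : IsPureState P v φ)
    (hψ : ∀ x ∈ P, 0 ≤ ψ x) {c : ℝ} (hle : ∀ x ∈ P, ψ x ≤ c * φ x) : ψ = ψ v • φ := by
  have hc : 0 ≤ c := by
    have := (hψ v hV.unit_mem).trans (hle v hV.unit_mem)
    rwa [hφ.map_unit, mul_one] at this
  have hc' : 0 < c + 1 := by linarith
  have := hφ.eq_smul ((c + 1)⁻¹ • ψ) (fun x hx => ?_) (fun x hx => ?_)
  · have := congrArg (fun f => (c + 1) • f) this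
    simpa [smul_smul, hc'.ne', mul_inv_cancel_left₀ hc'.ne'] using this
  · change 0 ≤ (c + 1)⁻¹ * ψ x
    have := hψ x hx
    positivity
  · change (c + 1)⁻¹ * ψ x ≤ φ x
    rw [inv_mul_le_iff₀ hc']
    have := hφ.nonneg x hx
    linarith [hle x hx]

/-- The open half space `{φ < 1}` of a pure state `φ` is upward directed. -/
lemma exists_upper_bound (hV : IsOrderUnitSpace V P v) {φ : V →L[ℝ] ℝ} (hφ : IsPureState P v φ)
    {x y : V} (hx : φ x < 1) (hy : φ y < 1) : ∃ z, φ z < 1 ∧ z - x ∈ P ∧ z - y ∈ P := by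
  by_contra! hno
  set O : Set (V × V) := {p | ∃ z, φ z < 1 ∧ z - p.1 ∈ openCone P v ∧ z - p.2 ∈ openCone P v}
    with hO
  have hopen : IsOpen O := by
    have : O = ⋃ z ∈ {z | φ z < 1}, ((fun p : V × V => z - p.1) ⁻¹' openCone P v ∩
        (fun p : V × V => z - p.2) ⁻¹' openCone P v) := by
      ext p
      simp [hO, and_left_comm]
    rw [this]
    exact isOpen_biUnion fun z _ => (hV.isOpen_openCone.preimage (by fun_prop)).inter
      (hV.isOpen_openCone.preimage (by fun_prop))
  have hconv : Convex ℝ O := by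
    rintro p ⟨z, hz, hz₁, hz₂⟩ q ⟨u, hu, hu₁, hu₂⟩ a b ha hb hab
    refine ⟨a • z + b • u, ?_, ?_, ?_⟩
    · exact (convex_halfSpace_lt φ.isLinear 1) hz hu ha hb hab
    · convert hV.convex_openCone hz₁ hu₁ ha hb hab using 1
      simp only [Prod.fst_add, Prod.smul_fst]
      module
    · convert hV.convex_openCone hz₂ hu₂ ha hb hab using 1
      simp only [Prod.snd_add, Prod.smul_snd]
      module
  have hxy : (x, y) ∉ O := fun ⟨z, hz, h₁, h₂⟩ =>
    hno z hz (hV.openCone_subset h₁) (hV.openCone_subset h₂)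
  obtain ⟨f, hf⟩ := geometric_hahn_banach_open_point hconv hopen hxy
  set ψ₁ : V →L[ℝ] ℝ := f.comp (ContinuousLinearMap.inl ℝ V V)
  set ψ₂ : V →L[ℝ] ℝ := f.comp (ContinuousLinearMap.inr ℝ V V)
  have hsum : ∀ a b, f (a, b) = ψ₁ a + ψ₂ b := fun a b => by
    simp [ψ₁, ψ₂, ← map_add]
  have hv := hV.unit_mem_openCone
  have h₁ : ∀ p ∈ P, 0 ≤ ψ₁ p := fun p hp =>
    hV.nonneg_of_bddBelow ψ₁ (-f (x, y) - ψ₂ v) (fun c hc => by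
      have := hf (-c, -v) ⟨0, by simp, by simpa using hc, by simpa using hv⟩
      rw [hsum (-c), map_neg, map_neg] at this
      linarith) hp
  have h₂ : ∀ p ∈ P, 0 ≤ ψ₂ p := fun p hp =>
    hV.nonneg_of_bddBelow ψ₂ (-f (x, y) - ψ₁ v) (fun c hc => by
      have := hf (-v, -c) ⟨0, by simp, by simpa using hv, by simpa using hc⟩
      rw [hsum (-v), map_neg, map_neg] at this
      linarith) hp
  have hker : ∀ z, φ z = 0 → ψ₁ z + ψ₂ z = 0 := by
    intro z hz
    by_contra hne
    have := hf ((((f (x, y) + ψ₁ v + ψ₂ v) / (ψ₁ z + ψ₂ z)) • z) - v,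
      (((f (x, y) + ψ₁ v + ψ₂ v) / (ψ₁ z + ψ₂ z)) • z) - v)
      ⟨((f (x, y) + ψ₁ v + ψ₂ v) / (ψ₁ z + ψ₂ z)) • z, by simp [hz], by simpa using hv,
        by simpa using hv⟩
    rw [hsum (_ - v), map_sub, map_sub, map_smul, map_smul, smul_eq_mul, smul_eq_mul] at this
    have e := div_mul_cancel₀ (f (x, y) + ψ₁ v + ψ₂ v) hne
    linarith
  have hmul : ∀ z, ψ₁ z + ψ₂ z = (ψ₁ v + ψ₂ v) * φ z := by
    intro z
    have := hker (z - φ z • v) (by simp [hφ.map_unit])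
    simp only [map_sub, map_smul, smul_eq_mul] at this
    linarith
  have e₁ := hV.eq_smul_of_le hφ h₁ (c := ψ₁ v + ψ₂ v) fun p hp => by
    linarith [hmul p, h₂ p hp]
  have e₂ := hV.eq_smul_of_le hφ h₂ (c := ψ₁ v + ψ₂ v) fun p hp => by
    linarith [hmul p, h₁ p hp]
  have hm : f (x, y) = ψ₁ v * φ x + ψ₂ v * φ y := by
    rw [hsum x y]
    exact congrArg₂ (· + ·) (congrArg (fun g : V →L[ℝ] ℝ => g x) e₁)
      (congrArg (fun g : V →L[ℝ] ℝ => g y) e₂)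
  have hpos : 0 < f (x, y) := by
    have := hf (0, 0) ⟨(2⁻¹ : ℝ) • v, by simp [hφ.map_unit]; norm_num,
      by simpa using hV.openCone_smul hv (by norm_num), by
      simpa using hV.openCone_smul hv (by norm_num)⟩
    rwa [hsum 0 0, map_zero, map_zero, add_zero] at this
  have hle : ψ₁ v + ψ₂ v ≤ f (x, y) := by
    by_contra! hlt
    have hc : 0 < ψ₁ v + ψ₂ v := hpos.trans hlt
    set t := f (x, y) / (ψ₁ v + ψ₂ v) with ht
    have ht1 : t < 1 := (div_lt_one hc).mpr hlt
    have hmem : ((1 + t) / 2) • v - t • v ∈ openCone P v := by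
      rw [← sub_smul]
      exact hV.openCone_smul hv (by linarith)
    have := hf (t • v, t • v) ⟨((1 + t) / 2) • v, by
      rw [map_smul, hφ.map_unit, smul_eq_mul]; linarith, hmem, hmem⟩
    rw [hsum (t • v), map_smul, map_smul, smul_eq_mul, smul_eq_mul, ← mul_add, ht,
      div_mul_cancel₀ _ hc.ne'] at this
    exact lt_irrefl _ this
  have p₁ := h₁ v hV.unit_mem
  have p₂ := h₂ v hV.unit_mem
  rcases p₁.eq_or_lt with p₁ | p₁ <;> rcases p₂.eq_or_lt with p₂ | p₂
  · rw [hm, ← p₁, ← p₂] at hpos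
    simp at hpos
  all_goals nlinarith

lemma exists_upper_bound_mem (hV : IsOrderUnitSpace V P v) {φ : V →L[ℝ] ℝ}
    (hφ : IsPureState P v φ) {x y : V} {t : ℝ} (ht : 0 < t) (hxC : x ∈ openCone P v)
    (hx : φ x < t) (hy : φ y < t) :
    ∃ z ∈ openCone P v, φ z < t ∧ z - x ∈ P ∧ z - y ∈ P := by
  have hscale : ∀ u : V, φ u < t → φ (t⁻¹ • u) < 1 := fun u hu => by
    rw [map_smul, smul_eq_mul, inv_mul_lt_iff₀ ht, mul_one]
    exact hu
  obtain ⟨z, hz, hzx, hzy⟩ := hV.exists_upper_bound hφ (hscale x hx) (hscale y hy)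
  have hback : ∀ u : V, z - t⁻¹ • u ∈ P → t • z - u ∈ P := fun u hu => by
    have := hV.smul_mem t ht.le _ hu
    rwa [smul_sub, smul_inv_smul₀ ht.ne'] at this
  refine ⟨t • z, hV.openCone_of_sub_mem hxC (hback x hzx), ?_, hback x hzx, hback y hzy⟩
  rw [map_smul, smul_eq_mul]
  nlinarith

/-- An order automorphism of the open cone which dominates the identity and is multiplication by
`μ` on the ray through the order unit is dominated by multiplication by `μ`. -/
lemma smul_sub_mem_of_orderAut (hV : IsOrderUnitSpace V P v) {F : V → V} {μ : ℝ} (hμ : 0 < μ)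
    (hmaps : ∀ x ∈ openCone P v, F x ∈ openCone P v)
    (hord : ∀ x ∈ openCone P v, ∀ y ∈ openCone P v, (y - x ∈ P ↔ F y - F x ∈ P))
    (hexp : ∀ x ∈ openCone P v, F x - x ∈ P)
    (hray : ∀ t : ℝ, 0 < t → F (t • v) = (μ * t) • v) {x : V} (hx : x ∈ openCone P v) :
    μ • x - F x ∈ P := by
  refine hV.mem_of_forall_isPureState fun φ hφ => ?_
  have hv := hV.unit_mem_openCone
  have hφC : ∀ y ∈ openCone P v, 0 < φ y := fun y hy =>
    pos_of_mem_openCone hφ.nonneg (by rw [hφ.map_unit]; exact one_pos) hy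
  have key : ∀ t δ : ℝ, φ x < t → 0 < δ → φ (F x) - δ < μ * t := by
    intro t δ hxt hδ
    have ht : 0 < t := (hφC x hx).trans hxt
    set J : Set V := {z | ∃ y ∈ openCone P v, φ y < t ∧ F y - z ∈ openCone P v} with hJ
    have hopen : IsOpen J := by
      have : J = ⋃ y ∈ {y | y ∈ openCone P v ∧ φ y < t},
          (fun z : V => F y - z) ⁻¹' openCone P v := by
        ext p
        simp [hJ, and_assoc]
      rw [this]
      exact isOpen_biUnion fun z _ => hV.isOpen_openCone.preimage (by fun_prop)
    have hconv : Convex ℝ J := by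
      rintro z₁ ⟨y₁, hy₁, hlt₁, h₁⟩ z₂ ⟨y₂, hy₂, hlt₂, h₂⟩ a b ha hb hab
      obtain ⟨y, hy, hlt, hle₁, hle₂⟩ := hV.exists_upper_bound_mem hφ ht hy₁ hlt₁ hlt₂
      refine ⟨y, hy, hlt, ?_⟩
      have g₁ := hV.openCone_add h₁ ((hord _ hy₁ _ hy).mp hle₁)
      have g₂ := hV.openCone_add h₂ ((hord _ hy₂ _ hy).mp hle₂)
      convert hV.convex_openCone g₁ g₂ ha hb hab using 1
      obtain rfl : b = 1 - a := by linarith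
      module
    have hpt : (μ * t) • v ∉ J := by
      rintro ⟨y, hy, hlt, h⟩
      rw [← hray t ht] at h
      have := hφ.nonneg _
        ((hord _ (hV.openCone_smul hv ht) _ hy).mpr (hV.openCone_subset h))
      rw [map_sub, map_smul, hφ.map_unit, smul_eq_mul, mul_one] at this
      linarith
    obtain ⟨f, hf⟩ := geometric_hahn_banach_open_point hconv hopen hpt
    rw [map_smul, smul_eq_mul] at hf
    have hnegJ : ∀ c ∈ openCone P v, -c ∈ J := fun c hc => by
      refine ⟨(t / 2) • v, hV.openCone_smul hv (by positivity), ?_, ?_⟩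
      · rw [map_smul, hφ.map_unit, smul_eq_mul]
        linarith
      · rw [sub_neg_eq_add, add_comm]
        exact hV.openCone_add hc
          (hV.openCone_subset (hmaps _ (hV.openCone_smul hv (by positivity))))
    have hfP : ∀ p ∈ P, 0 ≤ f p := fun p hp =>
      hV.nonneg_of_bddBelow f (-(μ * t * f v)) (fun c hc => by
        have := hf _ (hnegJ c hc)
        rw [map_neg] at this
        linarith) hp
    have hfv : 0 < f v := by
      refine (hfP v hV.unit_mem).lt_of_ne' fun h => ?_
      have := hf _ (hnegJ v hv)
      rw [hV.eq_zero_of_nonneg f hfP h] at this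
      simp at this
    have hK : 0 < μ * f v := by positivity
    have hle : ∀ p ∈ P, f p ≤ (μ * f v) * φ p := by
      intro p hp
      by_contra! hlt
      have hφp := hφ.nonneg p hp
      set d := f p - (μ * f v) * φ p with hd
      have hd0 : 0 < d := by linarith
      set η := d / (2 * (μ * f v)) with hη
      have hη0 : 0 < η := by positivity
      have hk : 0 < t / (φ p + 2 * η) := by positivity
      have hlt := hf ((t / (φ p + 2 * η)) • p) ⟨(t / (φ p + 2 * η)) • (p + η • v), ?_, ?_, ?_⟩
      · rw [map_smul, smul_eq_mul, div_mul_eq_mul_div, div_lt_iff₀ (by positivity)] at hlt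
        have : f p < μ * f v * (φ p + 2 * η) := by
          by_contra! h
          nlinarith
        have e : μ * f v * (2 * η) = d := by
          rw [hη]
          field_simp
        linarith
      · refine hV.openCone_smul ?_ hk
        rw [add_comm]
        exact hV.openCone_add (hV.openCone_smul hv hη0) hp
      · rw [map_smul, map_add, map_smul, hφ.map_unit, smul_eq_mul, smul_eq_mul, mul_one,
          div_mul_eq_mul_div, div_lt_iff₀ (by positivity)]
        nlinarith
      · have hm : (t / (φ p + 2 * η)) • (p + η • v) ∈ openCone P v := by
          refine hV.openCone_smul ?_ hk
          rw [add_comm]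
          exact hV.openCone_add (hV.openCone_smul hv hη0) hp
        convert hV.openCone_add (hV.openCone_smul hv (mul_pos hk hη0)) (hexp _ hm) using 1
        module
    have hfφ := hV.eq_smul_of_le hφ hfP hle
    have hlt := hf (F x - δ • v) ⟨x, hx, hxt, by
      simpa using hV.openCone_smul hv hδ⟩
    have e : f (F x - δ • v) = f v * (φ (F x) - δ) := by
      conv_lhs => rw [hfφ]
      change f v * φ (F x - δ • v) = _
      rw [map_sub, map_smul, hφ.map_unit, smul_eq_mul, mul_one]
    rw [e] at hlt
    by_contra! h
    nlinarith
  rw [map_sub, map_smul, smul_eq_mul]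
  by_contra! hneg
  set d := φ (F x) - μ * φ x with hd
  have hd0 : 0 < d := by linarith
  have := key (φ x + d / (2 * μ)) (d / 2) (by linarith [show 0 < d / (2 * μ) by positivity])
    (by positivity)
  have e : μ * (d / (2 * μ)) = d / 2 := by
    field_simp
  linarith [mul_add μ (φ x) (d / (2 * μ))]

end IsOrderUnitSpace

namespace GaugePreserving

variable {V : Type*} [NormedAddCommGroup V] [NormedSpace ℝ V] {P : Set V} {v : V}
variable {W : Type*} [NormedAddCommGroup W] [NormedSpace ℝ W] {Q : Set W} {w : W} {G : V → W}

lemma exists_inverse (hV : IsOrderUnitSpace V P v) (hG : GaugePreserving P v Q w G) :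
    ∃ H : W → V, GaugePreserving Q w P v H ∧ (∀ x ∈ openCone P v, H (G x) = x) ∧
      ∀ y ∈ openCone Q w, G (H y) = y := by
  obtain ⟨hbij, hhom, hord⟩ := hG
  have hinv := hbij.invOn_invFunOn
  set H := Function.invFunOn G (openCone P v)
  have hH : Set.BijOn H (openCone Q w) (openCone P v) := hbij.symm hinv.symm
  refine ⟨H, ⟨hH, fun y hy r hr => ?_, fun x hx y hy => ?_⟩, hinv.1, hinv.2⟩
  · have e := hhom (H y) (hH.mapsTo hy) r hr
    rw [hinv.2 hy] at e
    rw [← e, hinv.1 (hV.openCone_smul (hH.mapsTo hy) hr)]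
  · rw [hord _ (hH.mapsTo hx) _ (hH.mapsTo hy), hinv.2 hx, hinv.2 hy]

lemma add_sub_mem (hV : IsOrderUnitSpace V P v) (hW : IsOrderUnitSpace W Q w)
    (hG : GaugePreserving P v Q w G) {x y : V} (hx : x ∈ openCone P v) (hy : y ∈ openCone P v) :
    G x + G y - G (x + y) ∈ Q := by
  obtain ⟨hbij, hhom, hord⟩ := hG
  refine hW.mem_of_forall_isPureState fun φ hφ => ?_
  rw [map_sub, map_add, sub_nonneg]
  refine le_of_forall_pos_le_add fun ε hε => ?_
  have hφpos : ∀ z ∈ openCone P v, 0 < φ (G z) := fun z hz =>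
    IsOrderUnitSpace.pos_of_mem_openCone hφ.nonneg (by rw [hφ.map_unit]; exact one_pos)
      (hbij.mapsTo hz)
  have hscale : ∀ z ∈ openCone P v, 0 < φ (G z) + ε / 2 ∧
      (φ (G z) + ε / 2)⁻¹ • z ∈ openCone P v ∧ φ (G ((φ (G z) + ε / 2)⁻¹ • z)) < 1 := by
    intro z hz
    have h₀ := hφpos z hz
    have h : 0 < φ (G z) + ε / 2 := by positivity
    refine ⟨h, hV.openCone_smul hz (inv_pos.mpr h), ?_⟩
    rw [hhom z hz _ (inv_pos.mpr h), map_smul, smul_eq_mul, inv_mul_lt_iff₀ h]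
    linarith
  obtain ⟨hα, hxC, hx1⟩ := hscale x hx
  obtain ⟨hβ, hyC, hy1⟩ := hscale y hy
  set α := φ (G x) + ε / 2 with hαdef
  set β := φ (G y) + ε / 2 with hβdef
  obtain ⟨u, hu, hu1, hux, huy⟩ :=
    hW.exists_upper_bound_mem hφ one_pos (hbij.mapsTo hxC) hx1 hy1
  obtain ⟨z, hz, rfl⟩ := hbij.surjOn hu
  have hzx := hV.smul_mem α hα.le _ ((hord _ hxC _ hz).mpr hux)
  have hzy := hV.smul_mem β hβ.le _ ((hord _ hyC _ hz).mpr huy)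
  rw [smul_sub, smul_inv_smul₀ hα.ne'] at hzx
  rw [smul_sub, smul_inv_smul₀ hβ.ne'] at hzy
  have hle : (α + β) • z - (x + y) ∈ P := by
    convert hV.add_mem _ hzx _ hzy using 1
    module
  have h := hφ.nonneg _ ((hord _ (hV.openCone_add hx (hV.openCone_subset hy)) _
    (hV.openCone_smul hz (add_pos hα hβ))).mp hle)
  rw [hhom z hz _ (add_pos hα hβ), map_sub, map_smul, smul_eq_mul] at h
  nlinarith

lemma map_add (hV : IsOrderUnitSpace V P v) (hW : IsOrderUnitSpace W Q w)
    (hG : GaugePreserving P v Q w G) {x y : V} (hx : x ∈ openCone P v) (hy : y ∈ openCone P v) :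
    G (x + y) = G x + G y := by
  refine hW.antisymm (hG.add_sub_mem hV hW hx hy) ?_
  obtain ⟨H, hH, hHG, hGH⟩ := hG.exists_inverse hV
  obtain ⟨hbij, -, hord⟩ := hG
  have hGx := hbij.mapsTo hx
  have hGy := hbij.mapsTo hy
  have hsum := hW.openCone_add hGx (hW.openCone_subset hGy)
  have h := hH.add_sub_mem hW hV hGx hGy
  rw [hHG x hx, hHG y hy] at h
  have := (hord _ (hH.1.mapsTo hsum) _ (hV.openCone_add hx (hV.openCone_subset hy))).mp h
  rwa [hGH _ hsum] at this

/-- A gauge-preserving bijection between open cones extends to a linear order isomorphism. -/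
theorem exists_linear_orderIso (hV : IsOrderUnitSpace V P v) (hW : IsOrderUnitSpace W Q w)
    (hG : GaugePreserving P v Q w G) :
    ∃ T : V →ₗ[ℝ] W, Function.Bijective T ∧ (⇑T) '' P = Q := by
  have hadd := fun {x y} hx hy => hG.map_add (x := x) (y := y) hV hW hx hy
  obtain ⟨hbij, hhom, hord⟩ := hG
  have hdec : ∀ x : V, ∃ a ∈ openCone P v, ∃ b ∈ openCone P v, x = a - b := fun x => by
    obtain ⟨r, hr, h⟩ := hV.exists_smul_sub_mem hV.unit_mem_openCone x
    exact ⟨r • v, hV.openCone_smul hV.unit_mem_openCone hr, _, h, by abel⟩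
  choose a ha b hb hab using hdec
  have key : ∀ c ∈ openCone P v, ∀ d ∈ openCone P v,
      G (a (c - d)) - G (b (c - d)) = G c - G d := by
    intro c hc d hd
    have e : a (c - d) + d = c + b (c - d) := by
      rw [← sub_eq_sub_iff_add_eq_add]
      exact (hab (c - d)).symm
    rw [sub_eq_sub_iff_add_eq_add, ← hadd (ha _) hd, e, hadd hc (hb _)]
  have hCadd : ∀ c ∈ openCone P v, ∀ d ∈ openCone P v, c + d ∈ openCone P v :=
    fun c hc d hd => hV.openCone_add hc (hV.openCone_subset hd)
  let T : V →ₗ[ℝ] W :=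
    { toFun := fun x => G (a x) - G (b x)
      map_add' := fun x y => by
        have e : x + y = (a x + a y) - (b x + b y) := by
          conv_lhs => rw [hab x, hab y]
          abel
        rw [e, key _ (hCadd _ (ha x) _ (ha y)) _ (hCadd _ (hb x) _ (hb y)), hadd (ha x) (ha y),
          hadd (hb x) (hb y)]
        abel
      map_smul' := fun r x => by
        rw [RingHom.id_apply]
        rcases lt_trichotomy r 0 with hr | rfl | hr
        · have hr' : 0 < -r := neg_pos.mpr hr
          have e : r • x = (-r) • b x - (-r) • a x := by
            conv_lhs => rw [hab x]
            module
          rw [e, key _ (hV.openCone_smul (hb x) hr') _ (hV.openCone_smul (ha x) hr'),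
            hhom _ (hb x) _ hr', hhom _ (ha x) _ hr']
          module
        · have e : (0 : ℝ) • x = v - v := by simp
          rw [e, key _ hV.unit_mem_openCone _ hV.unit_mem_openCone, zero_smul, sub_self]
        · have e : r • x = r • a x - r • b x := by
            conv_lhs => rw [hab x]
            module
          rw [e, key _ (hV.openCone_smul (ha x) hr) _ (hV.openCone_smul (hb x) hr),
            hhom _ (ha x) _ hr, hhom _ (hb x) _ hr]
          module }
  have hT : ∀ x, T x = G (a x) - G (b x) := fun _ => rfl
  have hsurj : Function.Surjective T := by
    intro y
    obtain ⟨r, hr, h⟩ := hW.exists_smul_sub_mem hW.unit_mem_openCone y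
    obtain ⟨c, hc, hc'⟩ := hbij.surjOn (hW.openCone_smul hW.unit_mem_openCone hr)
    obtain ⟨d, hd, hd'⟩ := hbij.surjOn h
    refine ⟨c - d, ?_⟩
    rw [hT, key c hc d hd, hc', hd']
    abel
  have hmem : ∀ x, x ∈ P ↔ T x ∈ Q := fun x => by
    conv_lhs => rw [hab x]
    exact hord _ (hb x) _ (ha x)
  refine ⟨T, ⟨(injective_iff_map_eq_zero T).mpr fun x hx => ?_, hsurj⟩, ?_⟩
  · have e : G (a x) = G (b x) := sub_eq_zero.mp hx
    rw [hab x, hbij.injOn (ha x) (hb x) e, sub_self]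
  · ext y
    constructor
    · rintro ⟨x, hx, rfl⟩
      exact (hmem x).mp hx
    · intro hy
      obtain ⟨x, rfl⟩ := hsurj y
      exact ⟨x, (hmem x).mpr hy, rfl⟩

end GaugePreserving

namespace GaugeReversing

variable {V : Type*} [NormedAddCommGroup V] [NormedSpace ℝ V] {P : Set V} {v : V}
variable {W : Type*} [NormedAddCommGroup W] [NormedSpace ℝ W] {Q : Set W} {w : W} {Φ : V → W}

lemma comp_gaugePreserving {S : V → V}
    (hΦ : GaugeReversing P v Q w Φ) (hS : GaugeReversing P v P v S) :
    GaugePreserving P v Q w (Φ ∘ S) := by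
  obtain ⟨hSbij, hShom, hSord⟩ := hS
  obtain ⟨hbij, hhom, hord⟩ := hΦ
  refine ⟨hbij.comp hSbij, fun x hx r hr => ?_, fun x hx y hy => ?_⟩
  · simp only [Function.comp_apply]
    rw [hShom x hx r hr, hhom _ (hSbij.mapsTo hx) _ (inv_pos.mpr hr), inv_inv]
  · simp only [Function.comp_apply]
    rw [hSord x hx y hy, hord _ (hSbij.mapsTo hy) _ (hSbij.mapsTo hx)]

lemma exists_complement (hV : IsOrderUnitSpace V P v) (hW : IsOrderUnitSpace W Q w)
    (hΦ : GaugeReversing P v Q w Φ) {b : V} (hb : b ∈ openCone P v) :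
    ∃ c ∈ openCone P v, Φ (v + c) + Φ (v + b) = Φ v := by
  obtain ⟨hbij, hhom, hord⟩ := hΦ
  have hv := hV.unit_mem_openCone
  have hf := hbij.mapsTo hv
  have hvb := hV.openCone_add hv (hV.openCone_subset hb)
  have hd := hbij.mapsTo hvb
  have hsub : Φ v - Φ (v + b) ∈ openCone Q w := by
    obtain ⟨ε, hε, hb⟩ := hb
    have hε' : 0 < 1 + ε := by positivity
    have h := (hord _ (hV.openCone_smul hv hε') _ hvb).mp (by
      convert hb using 1
      module)
    rw [hhom v hv _ hε'] at h
    convert hW.openCone_add (hW.openCone_smul hf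
      (show 0 < 1 - (1 + ε)⁻¹ from sub_pos.mpr (inv_lt_one_of_one_lt₀ (by linarith)))) h using 1
    module
  obtain ⟨u, hu, hΦu⟩ := hbij.surjOn hsub
  obtain ⟨r, hr, hrd⟩ := hW.exists_smul_sub_mem hd (Φ v)
  have hs : 0 < 1 + r⁻¹ := by positivity
  have hle : Φ ((1 + r⁻¹) • v) - Φ u ∈ Q := by
    rw [hhom v hv _ hs, hΦu]
    convert hW.smul_mem (r + 1)⁻¹ (by positivity) _
      (hW.add_mem _ (hW.openCone_subset hrd) _ (hW.openCone_subset hd)) using 1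
    match_scalars <;> field_simp
    ring
  refine ⟨u - v, ⟨r⁻¹, by positivity, ?_⟩, ?_⟩
  · convert (hord _ (hV.openCone_smul hv hs) _ hu).mpr hle using 1
    module
  · rw [add_sub_cancel, hΦu, sub_add_cancel]

/-- The open cone of an order unit space which is the source of a gauge-reversing bijection
has a gauge-reversing self-bijection. -/
theorem exists_self (hV : IsOrderUnitSpace V P v) (hW : IsOrderUnitSpace W Q w)
    (hΦ : GaugeReversing P v Q w Φ) : ∃ S : V → V, GaugeReversing P v P v S := by
  have hcompl := fun b hb => hΦ.exists_complement (b := b) hV hW hb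
  choose! S hSC hS using hcompl
  obtain ⟨hbij, hhom, hord⟩ := hΦ
  have hv := hV.unit_mem_openCone
  have hvadd : ∀ b ∈ openCone P v, v + b ∈ openCone P v := fun b hb =>
    hV.openCone_add hv (hV.openCone_subset hb)
  have huniq : ∀ b ∈ openCone P v, ∀ c ∈ openCone P v, Φ (v + c) + Φ (v + b) = Φ v → S b = c := by
    intro b hb c hc h
    rw [← hS b hb, add_left_inj] at h
    exact (add_left_cancel (hbij.injOn (hvadd c hc) (hvadd _ (hSC b hb)) h)).symm
  have hinv : ∀ b ∈ openCone P v, S (S b) = b := fun b hb =>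
    huniq _ (hSC b hb) _ hb (by rw [add_comm]; exact hS b hb)
  have hanti : ∀ x ∈ openCone P v, ∀ y ∈ openCone P v, (y - x ∈ P ↔ S x - S y ∈ P) := by
    intro x hx y hy
    have e : Φ (v + x) - Φ (v + y) = Φ (v + S y) - Φ (v + S x) := by
      have h₁ := hS x hx
      have h₂ := hS y hy
      rw [sub_eq_sub_iff_add_eq_add, add_comm, h₁, h₂]
    rw [← add_sub_add_left_eq_sub y x v, hord _ (hvadd x hx) _ (hvadd y hy), e,
      ← hord _ (hvadd _ (hSC y hy)) _ (hvadd _ (hSC x hx)), add_sub_add_left_eq_sub]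
  have hray : ∀ t : ℝ, 0 < t → S (t • v) = t⁻¹ • v := by
    intro t ht
    have ht' : 0 < t⁻¹ := inv_pos.mpr ht
    refine huniq _ (hV.openCone_smul hv ht) _ (hV.openCone_smul hv ht') ?_
    have e : ∀ s : ℝ, v + s • v = (1 + s) • v := fun s => by module
    rw [e, e, hhom v hv _ (by positivity), hhom v hv _ (by positivity)]
    match_scalars
    field_simp
    ring
  have hle : ∀ κ : ℝ, 0 < κ → κ < 1 → ∀ b ∈ openCone P v, κ⁻¹ • S b - S (κ • b) ∈ P := by
    intro κ hκ hκ1 b hb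
    have hmaps : ∀ x ∈ openCone P v, κ • S x ∈ openCone P v := fun x hx =>
      hV.openCone_smul (hSC x hx) hκ
    have hscale : ∀ x y : V, (y - x ∈ P ↔ κ • y - κ • x ∈ P) := fun x y => by
      refine ⟨fun h => ?_, fun h => ?_⟩
      · rw [← smul_sub]
        exact hV.smul_mem κ hκ.le _ h
      · have := hV.smul_mem κ⁻¹ (inv_pos.mpr hκ).le _ h
        rwa [← smul_sub, inv_smul_smul₀ hκ.ne'] at this
    have h := hV.smul_sub_mem_of_orderAut (F := fun x => S (κ • S x)) (inv_pos.mpr hκ)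
      (fun x hx => hSC _ (hmaps x hx))
      (fun x hx y hy => by
        rw [hanti x hx y hy, hscale, hanti _ (hmaps y hy) _ (hmaps x hx)])
      (fun x hx => by
        have := (hanti _ (hmaps x hx) _ (hSC x hx)).mp (by
          convert hV.smul_mem (1 - κ) (by linarith) _ (hV.openCone_subset (hSC x hx)) using 1
          module)
        rwa [hinv x hx] at this)
      (fun t ht => by
        rw [hray t ht, smul_smul, hray _ (by positivity), mul_inv, inv_inv])
      (hSC b hb)
    simpa only [hinv b hb] using h
  have heq : ∀ κ : ℝ, 0 < κ → κ < 1 → ∀ b ∈ openCone P v, S (κ • b) = κ⁻¹ • S b := by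
    intro κ hκ hκ1 b hb
    refine hV.antisymm (hle κ hκ hκ1 b hb) ?_
    have hκ' : 0 < κ⁻¹ := inv_pos.mpr hκ
    have hκb := hV.openCone_smul hb hκ
    have h := hle κ hκ hκ1 _ (hSC _ hκb)
    rw [hinv _ hκb, inv_smul_smul₀ hκ.ne'] at h
    have h := (hanti _ (hSC _ (hV.openCone_smul (hSC _ hκb) hκ)) _ hb).mp h
    rw [hinv _ (hV.openCone_smul (hSC _ hκb) hκ)] at h
    have h := hV.smul_mem κ⁻¹ hκ'.le _ h
    rwa [smul_sub, inv_smul_smul₀ hκ.ne'] at h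
  refine ⟨S, ⟨hSC, fun x hx y hy h => ?_, fun y hy => ⟨S y, hSC y hy, hinv y hy⟩⟩,
    fun x hx r hr => ?_, hanti⟩
  · rw [← hinv x hx, h, hinv y hy]
  · rcases lt_trichotomy r 1 with hr1 | rfl | hr1
    · exact heq r hr hr1 x hx
    · simp
    · have h := heq r⁻¹ (inv_pos.mpr hr) (inv_lt_one_of_one_lt₀ hr1) _ (hV.openCone_smul hx hr)
      rw [inv_smul_smul₀ hr.ne', inv_inv] at h
      rw [h, inv_smul_smul₀ hr.ne']

end GaugeReversing

/-- If there is a gauge-reversing bijection between the open cones of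
two (not necessarily complete) order unit spaces, then the spaces are isomorphic as
ordered vector spaces. -/
theorem exists_linear_orderIso_of_gaugeReversing
    {V : Type*} [NormedAddCommGroup V] [NormedSpace ℝ V]
    {W : Type*} [NormedAddCommGroup W] [NormedSpace ℝ W]
    (P : Set V) (v : V) (Q : Set W) (w : W)
    (hV : IsOrderUnitSpace V P v) (hW : IsOrderUnitSpace W Q w)
    (Φ : V → W) (hΦ : GaugeReversing P v Q w Φ) :
    ∃ T : V →ₗ[ℝ] W, Function.Bijective T ∧ (⇑T) '' P = Q := by
  obtain ⟨S, hS⟩ := hΦ.exists_self hV hW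
  exact (hΦ.comp_gaugePreserving hS).exists_linear_orderIso hV hW
end

section
/- Let (V, V₊, v) and (W, W₊, w) be complete order unit spaces with open cones C := V₊° and D := W₊°, and let Φ: C → D be a gauge-reversing bijection. Then Φ is convex: for all x₁, x₂ ∈ C and λ ∈ [0,1] one has Φ((1−λ)x₁ + λx₂) ≤ (1−λ)Φ(x₁) + λΦ(x₂). -/
open scoped Topology

namespace IsOrderUnitSpace

variable {E : Type*} [NormedAddCommGroup E] [NormedSpace ℝ E] {Q : Set E} {w : E}

lemma zero_mem_s12 (h : IsOrderUnitSpace E Q w) : (0 : E) ∈ Q := by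
  simpa using h.smul_mem 0 le_rfl w h.unit_mem

lemma smul_unit_sub_mem (h : IsOrderUnitSpace E Q w) {x : E} {r : ℝ} (hr : ‖x‖ < r) :
    r • w - x ∈ Q := by
  have hne : {r : ℝ | 0 ≤ r ∧ x + r • w ∈ Q ∧ r • w - x ∈ Q}.Nonempty := by
    obtain ⟨a, ha, hax⟩ := h.unit_order x
    obtain ⟨b, hb, hbx⟩ := h.unit_order (-x)
    refine ⟨a + b, by positivity, ?_, ?_⟩
    · convert h.add_mem _ hbx _ (h.smul_mem a ha.le w h.unit_mem) using 1
      module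
    · convert h.add_mem _ hax _ (h.smul_mem b hb.le w h.unit_mem) using 1
      module
  rw [h.norm_eq] at hr
  obtain ⟨s, ⟨-, -, hs⟩, hsr⟩ := exists_lt_of_csInf_lt hne hr
  convert h.add_mem _ hs _ (h.smul_mem (r - s) (sub_nonneg.2 hsr.le) w h.unit_mem) using 1
  module

lemma convex (h : IsOrderUnitSpace E Q w) : Convex ℝ Q := fun x hx y hy a b ha hb _ =>
  h.add_mem _ (h.smul_mem a ha x hx) _ (h.smul_mem b hb y hy)

lemma mem_of_forall_add_smul_unit_mem (h : IsOrderUnitSpace E Q w) {x : E}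
    (hx : ∀ ε : ℝ, 0 < ε → x + ε • w ∈ Q) : x ∈ Q := by
  have := h.archimedean (-x) w fun r hr => by
    rcases hr.eq_or_lt with rfl | hr
    · simpa using h.unit_mem
    · convert h.smul_mem r hr.le _ (hx r⁻¹ (inv_pos.2 hr)) using 1
      rw [smul_add, smul_smul, mul_inv_cancel₀ hr.ne']
      module
  simpa using this

lemma isClosed (h : IsOrderUnitSpace E Q w) : IsClosed Q := by
  refine isClosed_of_closure_subset fun x hx => h.mem_of_forall_add_smul_unit_mem fun ε hε => ?_
  obtain ⟨y, hy, hxy⟩ := Metric.mem_closure_iff.1 hx ε hε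
  rw [dist_comm, dist_eq_norm] at hxy
  convert h.add_mem _ hy _ (h.smul_unit_sub_mem hxy) using 1
  module

/-- The dual norm of a positive functional is at most its value at the order unit. -/
lemma le_mul_norm (h : IsOrderUnitSpace E Q w) (f : E →ₗ[ℝ] ℝ)
    (hf : ∀ x ∈ Q, 0 ≤ f x) (x : E) : |f x| ≤ f w * ‖x‖ := by
  have key : ∀ y : E, f y ≤ f w * ‖y‖ := fun y => by
    have hw := hf w h.unit_mem
    refine le_of_forall_pos_le_add fun ε hε => ?_
    have h1 : ‖y‖ < ‖y‖ + ε / (f w + 1) := by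
      have : 0 < ε / (f w + 1) := by positivity
      linarith
    have h2 := hf _ (h.smul_unit_sub_mem h1)
    simp only [map_sub, map_smul, smul_eq_mul] at h2
    have h3 : ε / (f w + 1) * f w ≤ ε := by
      rw [div_mul_eq_mul_div, div_le_iff₀ (by positivity)]
      nlinarith
    nlinarith
  refine abs_le.2 ⟨?_, key x⟩
  have := key (-x)
  rw [map_neg, norm_neg] at this
  linarith

lemma eq_zero_of_unit_eq_zero (h : IsOrderUnitSpace E Q w) (f : E →ₗ[ℝ] ℝ)
    (hf : ∀ x ∈ Q, 0 ≤ f x) (hw : f w = 0) (x : E) : f x = 0 := by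
  have := h.le_mul_norm f hf x
  rw [hw, zero_mul] at this
  exact abs_nonpos_iff.1 this

lemma isCompact_stateSpace_s12 (h : IsOrderUnitSpace E Q w) : IsCompact (stateSpace Q w) := by
  have hcl : IsClosed (stateSpace Q w) := by
    have : stateSpace Q w =
        (⋂ x ∈ Q, {ρ : WeakDual ℝ E | 0 ≤ ρ x}) ∩ {ρ : WeakDual ℝ E | ρ w = 1} := by
      ext ρ
      simp [stateSpace]
    rw [this]
    exact (isClosed_biInter fun x _ => isClosed_le continuous_const
      (WeakDual.eval_continuous x)).inter
        (isClosed_eq (WeakDual.eval_continuous w) continuous_const)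
  refine (WeakDual.isCompact_closedBall (𝕜 := ℝ) (E := E) 0 1).of_isClosed_subset hcl
    fun ρ hρ => ?_
  rw [Set.mem_preimage, mem_closedBall_zero_iff]
  refine ContinuousLinearMap.opNorm_le_bound _ zero_le_one fun x => ?_
  have := h.le_mul_norm (WeakDual.toStrongDual ρ).toLinearMap hρ.1 x
  have hw : (WeakDual.toStrongDual ρ) w = 1 := hρ.2
  simpa [hw] using this

/-- The positive cone is determined by the pure states. -/
lemma mem_of_forall_extremePoints_nonneg (h : IsOrderUnitSpace E Q w) {z : E}
    (hz : ∀ ψ ∈ (stateSpace Q w).extremePoints ℝ, 0 ≤ ψ z) : z ∈ Q := by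
  by_contra hzQ
  let C : ProperCone ℝ E :=
    { carrier := Q
      add_mem' := fun ha hb => h.add_mem _ ha _ hb
      zero_mem' := h.zero_mem_s12
      smul_mem' := fun c x hx => h.smul_mem c c.2 x hx
      isClosed' := h.isClosed }
  obtain ⟨f, hf, hfz⟩ := C.hyperplane_separation_point (x₀ := z) hzQ
  have hf' : ∀ x ∈ Q, 0 ≤ f x := hf
  have hw : 0 < f w := (hf' w h.unit_mem).lt_of_ne' fun h0 =>
    hfz.ne (h.eq_zero_of_unit_eq_zero f.toLinearMap hf' h0 z)
  let ρ : WeakDual ℝ E := StrongDual.toWeakDual ((f w)⁻¹ • f)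
  have hρ : ∀ x, ρ x = (f w)⁻¹ * f x := fun x => rfl
  have hρK : ρ ∈ stateSpace Q w :=
    ⟨fun x hx => by rw [hρ]; exact mul_nonneg (inv_nonneg.2 hw.le) (hf' x hx),
      by rw [hρ, inv_mul_cancel₀ hw.ne']⟩
  let ev : StrongDual ℝ (WeakDual ℝ E) :=
    { toFun := fun ψ => ψ (-z)
      map_add' := fun _ _ => rfl
      map_smul' := fun _ _ => rfl
      cont := WeakDual.eval_continuous (-z) }
  have hev : ∀ ψ, ev ψ = -ψ z := fun ψ => map_neg ψ z
  have hexp : IsExposed ℝ (stateSpace Q w) (ev.toExposed (stateSpace Q w)) :=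
    ContinuousLinearMap.toExposed.isExposed
  obtain ⟨σ, hσ, hmax⟩ := h.isCompact_stateSpace_s12.exists_isMaxOn ⟨ρ, hρK⟩ ev.continuous.continuousOn
  have : LocallyConvexSpace ℝ (WeakDual ℝ E) := WeakBilin.locallyConvexSpace
  obtain ⟨ψ, hψ⟩ := (hexp.isCompact h.isCompact_stateSpace_s12).extremePoints_nonempty
    ⟨σ, hσ, fun τ hτ => hmax hτ⟩
  have h1 := hz ψ (hexp.isExtreme.extremePoints_subset_extremePoints hψ)
  have h2 := hψ.1.2 ρ hρK
  rw [hev, hev, hρ] at h2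
  have h3 : (f w)⁻¹ * f z < 0 := mul_neg_of_pos_of_neg (inv_pos.2 hw) hfz
  linarith

/-- A positive functional dominated by a pure state is a multiple of it. -/
lemma eq_mul_of_le_of_mem_extremePoints (h : IsOrderUnitSpace E Q w) {ψ : WeakDual ℝ E}
    (hψ : ψ ∈ (stateSpace Q w).extremePoints ℝ) (f : StrongDual ℝ E)
    (hf : ∀ x ∈ Q, 0 ≤ f x) (hfψ : ∀ x ∈ Q, f x ≤ ψ x) (x : E) : f x = f w * ψ x := by
  have hw1 : ψ w = 1 := hψ.1.2
  have h0 := hf w h.unit_mem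
  have h1 := hfψ w h.unit_mem
  let g : StrongDual ℝ E := WeakDual.toStrongDual ψ - f
  have hg : ∀ x, g x = ψ x - f x := fun x => rfl
  have hgQ : ∀ x ∈ Q, 0 ≤ g x := fun x hx => by rw [hg]; linarith [hfψ x hx]
  rw [hw1] at h1
  rcases h0.eq_or_lt with h0 | h0
  · rw [← h0, zero_mul]
    exact h.eq_zero_of_unit_eq_zero f.toLinearMap hf h0.symm x
  rcases h1.eq_or_lt with h1 | h1
  · have : g x = 0 := h.eq_zero_of_unit_eq_zero g.toLinearMap hgQ
      (show g w = 0 by rw [hg, hw1, h1, sub_self]) x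
    rw [hg] at this
    rw [h1]
    linarith
  let φ₁ : WeakDual ℝ E := StrongDual.toWeakDual ((f w)⁻¹ • f)
  let φ₂ : WeakDual ℝ E := StrongDual.toWeakDual ((1 - f w)⁻¹ • g)
  have e₁ : ∀ y, φ₁ y = (f w)⁻¹ * f y := fun y => rfl
  have e₂ : ∀ y, φ₂ y = (1 - f w)⁻¹ * (ψ y - f y) := fun y => rfl
  have h1' : 0 < 1 - f w := sub_pos.2 h1
  have m₁ : φ₁ ∈ stateSpace Q w :=
    ⟨fun y hy => by rw [e₁]; exact mul_nonneg (inv_nonneg.2 h0.le) (hf y hy),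
      by rw [e₁, inv_mul_cancel₀ h0.ne']⟩
  have m₂ : φ₂ ∈ stateSpace Q w :=
    ⟨fun y hy => by rw [e₂]; exact mul_nonneg (inv_nonneg.2 h1'.le) (hgQ y hy),
      by rw [e₂, hw1, inv_mul_cancel₀ h1'.ne']⟩
  have hseg : ψ ∈ openSegment ℝ φ₁ φ₂ := by
    refine ⟨f w, 1 - f w, h0, h1', by ring, ?_⟩
    refine DFunLike.ext _ _ fun y => ?_
    change f w * φ₁ y + (1 - f w) * φ₂ y = ψ y
    rw [e₁, e₂, mul_inv_cancel_left₀ h0.ne', mul_inv_cancel_left₀ h1'.ne']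
    ring
  have := hψ.2 m₁ m₂ hseg
  rw [← this, e₁, mul_inv_cancel_left₀ h0.ne']

/-- At a pure state, the infimum of the values of the upper bounds of `0` and `d` is the
maximum of the values of `0` and `d`. -/
lemma exists_upper_bound_lt (h : IsOrderUnitSpace E Q w) {ψ : WeakDual ℝ E}
    (hψ : ψ ∈ (stateSpace Q w).extremePoints ℝ) {d : E} (hd : ψ d ≤ 0) {ε : ℝ} (hε : 0 < ε) :
    ∃ k ∈ Q, k - d ∈ Q ∧ ψ k < ε := by
  have hw1 : ψ w = 1 := hψ.1.2
  let A : Set E := {x | ∃ k ∈ Q, k - x ∈ Q ∧ ψ k < ε}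
  have hA : Convex ℝ A := by
    rintro x ⟨k, hk, hkx, hkε⟩ y ⟨l, hl, hly, hlε⟩ a b ha hb hab
    refine ⟨a • k + b • l, h.convex hk hl ha hb hab, ?_, ?_⟩
    · convert h.convex hkx hly ha hb hab using 1
      module
    · have := (convex_Iio ε) hkε hlε ha hb hab
      simpa using this
  have hAo : IsOpen A := by
    refine Metric.isOpen_iff.2 fun x hx => ?_
    obtain ⟨k, hk, hkx, hkε⟩ := hx
    refine ⟨(ε - ψ k) / 2, by linarith, fun y hy => ?_⟩
    rw [mem_ball_iff_norm] at hy
    refine ⟨k + ((ε - ψ k) / 2) • w,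
      h.add_mem _ hk _ (h.smul_mem _ (by linarith) w h.unit_mem), ?_, ?_⟩
    · convert h.add_mem _ hkx _ (h.smul_unit_sub_mem hy) using 1
      module
    · rw [map_add, map_smul, hw1, smul_eq_mul]
      linarith
  by_contra hcon
  obtain ⟨f, hf⟩ := geometric_hahn_banach_open_point hA hAo (x := d) hcon
  have hfd : 0 < f d := by
    simpa using hf 0 ⟨0, h.zero_mem_s12, by simpa using h.zero_mem_s12, by simpa using hε⟩
  have hfQ : ∀ x ∈ Q, 0 ≤ f x := fun x hx => by
    by_contra! hneg
    have hc : 0 ≤ f d / -f x := div_nonneg hfd.le (by linarith)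
    have := hf (-((f d / -f x) • x)) ⟨0, h.zero_mem_s12, by
      simpa using h.smul_mem _ hc x hx, by simpa using hε⟩
    rw [map_neg, map_smul, smul_eq_mul, ← mul_neg, div_mul_cancel₀ _ (by linarith)] at this
    exact this.false
  have hfψ : ∀ x ∈ Q, ε * f x ≤ f d * ψ x := fun x hx => by
    have hx0 : 0 ≤ ψ x := hψ.1.1 x hx
    by_contra! hlt
    have hfx : 0 < f x := pos_of_mul_pos_right (lt_of_le_of_lt (mul_nonneg hfd.le hx0) hlt) hε.le
    have hc : 0 ≤ f d / f x := div_nonneg hfd.le hfx.le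
    have := hf ((f d / f x) • x) ⟨_, h.smul_mem _ hc x hx, by simpa using h.zero_mem_s12, by
      rw [map_smul, smul_eq_mul, div_mul_eq_mul_div, div_lt_iff₀ hfx]
      exact hlt⟩
    rw [map_smul, smul_eq_mul, div_mul_cancel₀ _ hfx.ne'] at this
    exact this.false
  have hc : 0 < ε / f d := div_pos hε hfd
  have key := h.eq_mul_of_le_of_mem_extremePoints hψ ((ε / f d) • f)
    (fun x hx => mul_nonneg hc.le (hfQ x hx))
    (fun x hx => by
      change ε / f d * f x ≤ ψ x
      rw [div_mul_eq_mul_div, div_le_iff₀ hfd]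
      linarith [hfψ x hx]) d
  change ε / f d * f d = ε / f d * f w * ψ d at key
  rw [div_mul_cancel₀ _ hfd.ne'] at key
  have := mul_nonpos_of_nonneg_of_nonpos (mul_nonneg hc.le (hfQ w h.unit_mem)) hd
  linarith

lemma smul_mem_openCone (h : IsOrderUnitSpace E Q w) {x : E} (hx : x ∈ openCone Q w) {a : ℝ}
    (ha : 0 < a) : a • x ∈ openCone Q w := by
  obtain ⟨ε, hε, hx⟩ := hx
  refine ⟨a * ε, mul_pos ha hε, ?_⟩
  convert h.smul_mem a ha.le _ hx using 1
  module

lemma add_mem_openCone (h : IsOrderUnitSpace E Q w) {x y : E} (hx : x ∈ openCone Q w)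
    (hy : y ∈ Q) : x + y ∈ openCone Q w := by
  obtain ⟨ε, hε, hx⟩ := hx
  refine ⟨ε, hε, ?_⟩
  convert h.add_mem _ hx _ hy using 1
  module

lemma mem_of_mem_openCone (h : IsOrderUnitSpace E Q w) {x : E} (hx : x ∈ openCone Q w) :
    x ∈ Q := by
  obtain ⟨ε, hε, hx⟩ := hx
  convert h.add_mem _ hx _ (h.smul_mem ε hε.le w h.unit_mem) using 1
  module

lemma convex_openCone_s12 (h : IsOrderUnitSpace E Q w) : Convex ℝ (openCone Q w) := by
  refine convex_iff_forall_pos.2 fun x hx y hy a b ha hb _ => ?_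
  exact h.add_mem_openCone (h.smul_mem_openCone hx ha) (h.smul_mem b hb.le y
    (h.mem_of_mem_openCone hy))

lemma state_pos_of_mem_openCone {ψ : WeakDual ℝ E}
    (hψ : ψ ∈ stateSpace Q w) {x : E} (hx : x ∈ openCone Q w) : 0 < ψ x := by
  obtain ⟨ε, hε, hx⟩ := hx
  have := hψ.1 _ hx
  rw [map_sub, map_smul, hψ.2, smul_eq_mul] at this
  linarith

end IsOrderUnitSpace

/-- An upper bound `u` of `a • Φ x₁` and `b • Φ x₂` dominates a multiple of the value of a
gauge-reversing map at a convex combination of `x₁` and `x₂`. -/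
lemma GaugeReversing.smul_le_of_smul_le
    {V : Type*} [NormedAddCommGroup V] [NormedSpace ℝ V]
    {W : Type*} [NormedAddCommGroup W] [NormedSpace ℝ W]
    {P : Set V} {v : V} {Q : Set W} {w : W}
    (hV : IsOrderUnitSpace V P v) (hW : IsOrderUnitSpace W Q w)
    {Φ : V → W} (hΦ : GaugeReversing P v Q w Φ) {x₁ x₂ : V}
    (hx₁ : x₁ ∈ openCone P v) (hx₂ : x₂ ∈ openCone P v) {s t : ℝ} (hs : 0 ≤ s) (ht : 0 ≤ t)
    (hst : s + t = 1) {a b : ℝ} (ha : 0 < a) (hb : 0 < b) {u : W}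
    (hau : u - a • Φ x₁ ∈ Q) (hbu : u - b • Φ x₂ ∈ Q) :
    u - (s * a + t * b) • Φ (s • x₁ + t • x₂) ∈ Q := by
  obtain ⟨hbij, hhom, hord⟩ := hΦ
  have hu : u ∈ openCone Q w := by
    convert hW.add_mem_openCone (hW.smul_mem_openCone (hbij.mapsTo hx₁) ha) hau using 1
    module
  obtain ⟨y, hy, rfl⟩ := hbij.surjOn hu
  have scale : ∀ z ∈ openCone P v, ∀ c : ℝ, 0 < c → (z - c • y ∈ P ↔ Φ y - c • Φ z ∈ Q) := by
    intro z hz c hc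
    have h := hord y hy (c⁻¹ • z) (hV.smul_mem_openCone hz (inv_pos.2 hc))
    rw [hhom z hz _ (inv_pos.2 hc), inv_inv] at h
    rw [← h]
    constructor
    · intro hm
      convert hV.smul_mem c⁻¹ (inv_pos.2 hc).le _ hm using 1
      rw [smul_sub, inv_smul_smul₀ hc.ne']
    · intro hm
      convert hV.smul_mem c hc.le _ hm using 1
      rw [smul_sub, smul_inv_smul₀ hc.ne']
  have hpos : 0 < s * a + t * b := (convex_Ioi (0 : ℝ)) ha hb hs ht hst
  refine (scale _ (hV.convex_openCone_s12 hx₁ hx₂ hs ht hst) _ hpos).1 ?_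
  convert hV.convex ((scale _ hx₁ _ ha).2 hau) ((scale _ hx₂ _ hb).2 hbu) hs ht hst using 1
  module

/-- A gauge-reversing bijection `Φ` between the open cones of two
complete order unit spaces is convex:
`Φ((1−t) x₁ + t x₂) ≤ (1−t) Φ(x₁) + t Φ(x₂)` for `x₁, x₂` in the open cone, `t ∈ [0,1]`. -/
theorem gaugeReversing_convex
    {V : Type*} [NormedAddCommGroup V] [NormedSpace ℝ V] [CompleteSpace V]
    {W : Type*} [NormedAddCommGroup W] [NormedSpace ℝ W] [CompleteSpace W]
    (P : Set V) (v : V) (Q : Set W) (w : W)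
    (hV : IsOrderUnitSpace V P v) (hW : IsOrderUnitSpace W Q w)
    (Φ : V → W) (hΦ : GaugeReversing P v Q w Φ) :
    ∀ x₁ ∈ openCone P v, ∀ x₂ ∈ openCone P v, ∀ t : ℝ, 0 ≤ t → t ≤ 1 →
      ((1 - t) • Φ x₁ + t • Φ x₂) - Φ ((1 - t) • x₁ + t • x₂) ∈ Q := by
  intro x₁ hx₁ x₂ hx₂ t ht0 ht1
  have hs : 0 ≤ 1 - t := sub_nonneg.2 ht1
  refine hW.mem_of_forall_extremePoints_nonneg fun ψ hψ => ?_
  set r := Φ ((1 - t) • x₁ + t • x₂) with hr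
  have hp : 0 < ψ (Φ x₁) :=
    IsOrderUnitSpace.state_pos_of_mem_openCone hψ.1 (hΦ.1.mapsTo hx₁)
  have hq : 0 < ψ (Φ x₂) :=
    IsOrderUnitSpace.state_pos_of_mem_openCone hψ.1 (hΦ.1.mapsTo hx₂)
  rw [map_sub, map_add, map_smul, map_smul, smul_eq_mul, smul_eq_mul]
  set p := ψ (Φ x₁) with hpdef
  set q := ψ (Φ x₂) with hqdef
  have hd : ψ (q⁻¹ • Φ x₂ - p⁻¹ • Φ x₁) ≤ 0 := by
    rw [map_sub, map_smul, map_smul, smul_eq_mul, smul_eq_mul, ← hpdef, ← hqdef,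
      inv_mul_cancel₀ hp.ne', inv_mul_cancel₀ hq.ne', sub_self]
  have harm : ((1 - t) * p⁻¹ + t * q⁻¹) * ψ r ≤ 1 := by
    refine le_of_forall_pos_le_add fun ε hε => ?_
    obtain ⟨k, hk, hkd, hkε⟩ := hW.exists_upper_bound_lt hψ hd hε
    have := hψ.1.1 _ (hΦ.smul_le_of_smul_le hV hW hx₁ hx₂ hs ht0 (by ring)
      (inv_pos.2 hp) (inv_pos.2 hq) (u := p⁻¹ • Φ x₁ + k)
      (by simpa using hk) (by convert hkd using 1; module))
    rw [map_sub, map_add, map_smul, map_smul, smul_eq_mul, smul_eq_mul, ← hpdef,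
      inv_mul_cancel₀ hp.ne', ← hr] at this
    linarith
  have hc : 0 < (1 - t) * p⁻¹ + t * q⁻¹ :=
    (convex_Ioi (0 : ℝ)) (inv_pos.2 hp) (inv_pos.2 hq) hs ht0 (by ring)
  have hmean : 1 ≤ ((1 - t) * p⁻¹ + t * q⁻¹) * ((1 - t) * p + t * q) := by
    have : ((1 - t) * p⁻¹ + t * q⁻¹) * ((1 - t) * p + t * q) - 1
        = t * (1 - t) * (p - q) ^ 2 / (p * q) := by
      field_simp
      ring
    have h0 : 0 ≤ t * (1 - t) * (p - q) ^ 2 / (p * q) := by positivity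
    linarith
  have := le_of_mul_le_mul_left (harm.trans hmean) hc
  linarith
end
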